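/- arXiv:2011.09904 — 4 statements merged into one kernel-verified Lean document; each statement's English description precedes it below -/
import Mathlib

section
/- Let L be a field and K a subring of L, and let T = K + X·L[X] be the subring of L[X] consisting of all polynomials whose constant term lies in K. If there exists a nonzero ideal I of L[X] that is finitely generated as a T-module, then K is a field and L is a finite-dimensional vector space over K. -/
/-- The polynomial composite `K + X·L[X]` for a subring `K` of a field `L`:
the subring of `L[X]` consisting of all polynomials whose constant term lies in `K`. -/
def polynomialComposite {L : Type*} [Field L] (K : Subring L) :
    Subring (Polynomial L) where
  carrier := {p | p.coeff 0 ∈ K}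
  mul_mem' := by
    intro a b ha hb
    simp only [Set.mem_setOf_eq, Polynomial.mul_coeff_zero] at *
    exact mul_mem ha hb
  one_mem' := by simpa using one_mem K
  add_mem' := by
    intro a b ha hb
    simp only [Set.mem_setOf_eq, Polynomial.coeff_add] at *
    exact add_mem ha hb
  zero_mem' := by simpa using zero_mem K
  neg_mem' := by
    intro a ha
    simp only [Set.mem_setOf_eq, Polynomial.coeff_neg] at *
    exact neg_mem ha

open Polynomial in
/-- If a nonzero ideal of `L[X]` is finitely generated over `K + X·L[X]`, then so is `L` over `K`:
dividing the generators by a generator of the ideal and taking constant terms spans `L`. -/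
theorem finite_of_fg_ideal_polynomialComposite {L : Type*} [Field L] (K : Subring L)
    {I : Ideal L[X]} (hI : I ≠ ⊥)
    (hfg : (Submodule.restrictScalars (polynomialComposite K) I).FG) : Module.Finite K L := by
  classical
  obtain ⟨f, rfl⟩ : ∃ f : L[X], I = Ideal.span {f} := (IsPrincipalIdealRing.principal I).principal
  have hf : f ≠ 0 := fun h => hI (by simp [h])
  obtain ⟨S, hS⟩ := hfg
  set N : Submodule K L := Submodule.span K (S.image fun g => (g / f).coeff 0 : Finset L) with hN
  have key (g : L[X]) (hg : g ∈ Submodule.span (polynomialComposite K) (S : Set L[X])) :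
      ∃ q, g = f * q ∧ q.coeff 0 ∈ N := by
    induction hg using Submodule.span_induction with
    | mem s hs =>
      have hsI : s ∈ Submodule.restrictScalars (polynomialComposite K) (Ideal.span {f}) :=
        hS ▸ Submodule.subset_span hs
      obtain ⟨q, rfl⟩ := Ideal.mem_span_singleton.mp hsI
      refine ⟨q, rfl, Submodule.subset_span ?_⟩
      exact Finset.mem_coe.mpr
        (Finset.mem_image.mpr ⟨f * q, hs, by rw [mul_div_cancel_left₀ q hf]⟩)
    | zero => exact ⟨0, by simp, by simp⟩
    | add a b _ _ ha hb =>
      obtain ⟨q, rfl, hq⟩ := ha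
      obtain ⟨r, rfl, hr⟩ := hb
      exact ⟨q + r, by ring, by simpa using N.add_mem hq hr⟩
    | smul t a _ ha =>
      obtain ⟨q, rfl, hq⟩ := ha
      refine ⟨t * q, by rw [Subring.smul_def, smul_eq_mul]; ring, ?_⟩
      rw [mul_coeff_zero]
      exact N.smul_mem (⟨t.1.coeff 0, t.2⟩ : K) hq
  refine ⟨⟨_, hN.symm.trans (eq_top_iff.mpr fun l _ => ?_)⟩⟩
  have hl : f * C l ∈ Submodule.restrictScalars (polynomialComposite K) (Ideal.span {f}) :=
    Ideal.mem_span_singleton.mpr (dvd_mul_right _ _)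
  obtain ⟨q, hq, hqN⟩ := key _ (hS ▸ hl)
  rwa [← mul_left_cancel₀ hf hq, coeff_C_zero] at hqN

theorem field_and_finite_of_fg_ideal
    {L : Type*} [Field L] (K : Subring L) (I : Ideal (Polynomial L))
    (hI : I ≠ ⊥)
    (hfg : (Submodule.restrictScalars (polynomialComposite K) I).FG) :
    IsField K ∧ Module.Finite K L := by
  have hfin : Module.Finite K L := finite_of_fg_ideal_polynomialComposite K hI hfg
  have : Algebra.IsIntegral K L := Algebra.IsIntegral.of_finite K L
  exact ⟨isField_of_isIntegral_of_isField (S := L) Subtype.val_injective (Field.toIsField L), hfin⟩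
end

section
/- Let M be an algebraically closed field that is algebraic over a subfield K, and let L be an intermediate field with K ⊆ L ⊆ M. Then L is separable over K if and only if the tensor product M ⊗_K L has no nonzero nilpotent elements (i.e., M ⊗_K L is a reduced ring). -/
open TensorProduct

theorem linearIndependent_one_tmul_baseChange {ι K V : Type*} (A : Type*) [Field K]
    [AddCommGroup V] [Module K V] [CommRing A] [Algebra K A] {v : ι → V}
    (hv : LinearIndependent K v) :
    LinearIndependent A fun i ↦ (1 : A) ⊗ₜ[K] v i := by
  have h := ((Module.Basis.extend hv.linearIndepOn_id).baseChange A).linearIndependent.comp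
    (fun i ↦ ⟨v i, hv.linearIndepOn_id.subset_extend _ ⟨i, rfl⟩⟩)
    (fun i j hij ↦ hv.injective (congrArg Subtype.val hij))
  convert! h using 2 with i
  simp

theorem minpoly_one_tmul_eq_map {K B : Type*} (A : Type*) [Field K] [CommRing B]
    [Algebra K B] [Field A] [Algebra K A] {x : B} (hx : IsIntegral K x) :
    minpoly A ((1 : A) ⊗ₜ[K] x) = (minpoly K x).map (algebraMap K A) := by
  refine minpoly.eq_of_linearIndependent _ _ ((minpoly.monic hx).map _) ?_
    (minpoly K x).natDegree ?_ ?_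
  · rw [Polynomial.aeval_map_algebraMap, ← Algebra.TensorProduct.includeRight_apply,
      Polynomial.aeval_algHom_apply, minpoly.aeval, map_zero]
  · rw [Polynomial.degree_map, Polynomial.degree_eq_natDegree (minpoly.ne_zero hx)]
  · simpa [Algebra.TensorProduct.tmul_pow] using
      linearIndependent_one_tmul_baseChange A (linearIndependent_pow (K := K) x)

theorem isSeparable_of_isReduced_tensorProduct {K B : Type*} (A : Type*) [Field K] [CommRing B]
    [Algebra K B] [Algebra.IsIntegral K B] [Field A] [PerfectField A] [Algebra K A]
    [IsReduced (A ⊗[K] B)] : Algebra.IsSeparable K B := by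
  refine ⟨fun x ↦ ?_⟩
  have hx := Algebra.IsIntegral.isIntegral (R := K) x
  have hrad := minpoly.isRadical A ((1 : A) ⊗ₜ[K] x)
  rw [minpoly_one_tmul_eq_map A hx] at hrad
  have hsq := hrad.squarefree ((minpoly.monic hx).map _).ne_zero
  exact Polynomial.separable_map (algebraMap K A) |>.mp
    (PerfectField.separable_iff_squarefree.mpr hsq)

theorem isReduced_tensorProduct_of_isSeparable (K L A : Type*) [Field K] [Field L] [Field A]
    [Algebra K L] [Algebra K A] [Algebra.IsSeparable K L] : IsReduced (A ⊗[K] L) := by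
  refine IsReduced.tensorProduct_of_flat_of_forall_fg fun B hB ↦ ?_
  let : Field B := (Subalgebra.isField_of_algebraic B).toField
  have : Algebra.IsSeparable K B := .of_algHom K L B.val
  have : Algebra.FiniteType K B := B.fg_iff_finiteType.mp hB
  have := Algebra.FormallyUnramified.of_isSeparable K B
  exact Algebra.FormallyUnramified.isReduced_of_field A (A ⊗[K] B)

theorem separable_iff_tensor_reduced_of_intermediate
    (K L M : Type*) [Field K] [Field L] [Field M]
    [Algebra K L] [Algebra L M] [Algebra K M] [IsScalarTower K L M]
    [IsAlgClosed M] [Algebra.IsAlgebraic K M] :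
    Algebra.IsSeparable K L ↔ IsReduced (M ⊗[K] L) := by
  have : Algebra.IsAlgebraic K L := .tower_bot K L M
  exact ⟨fun _ ↦ isReduced_tensorProduct_of_isSeparable K L M,
    fun _ ↦ isSeparable_of_isReduced_tensorProduct M⟩
end

section
/- Let M be an algebraically closed field that is algebraic over a subfield K, and let L be an intermediate field with K ⊆ L ⊆ M. Then L is separable over K if and only if the tensor product M ⊗_K L is generated as an M-algebra by its idempotent elements. -/
open TensorProduct

section Idempotents

open Polynomial

variable {F A : Type*} [Field F] [CommRing A] [Algebra F A]

theorem aeval_mul_eq_of_mul_eq {x y e : A} (h : x * e = y * e) (q : F[X]) :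
    aeval x q * e = aeval y q * e := by
  obtain ⟨z, hz⟩ := sub_dvd_eval_sub x y (q.map (algebraMap F A))
  rw [eval_map_algebraMap, eval_map_algebraMap] at hz
  linear_combination e * hz + z * h

theorem exists_aeval_prod_X_sub_C_eq_zero_add_smul {a e : A} (he : IsIdempotentElem e) (c : F)
    (h : ∃ t : Finset F, aeval a (∏ r ∈ t, (X - C r)) = 0) :
    ∃ t : Finset F, aeval (a + c • e) (∏ r ∈ t, (X - C r)) = 0 := by
  classical
  obtain ⟨t, ht⟩ := h
  have he' : e * e = e := he
  refine ⟨t ∪ t.image (· + c), ?_⟩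
  set q : F[X] := ∏ r ∈ t ∪ t.image (· + c), (X - C r) with hq
  have h₁ : aeval a q = 0 :=
    zero_dvd_iff.mp (ht ▸ map_dvd (aeval a)
      (Finset.prod_dvd_prod_of_subset _ _ _ Finset.subset_union_left))
  have h₂ : aeval (a + algebraMap F A c) q = 0 := by
    have hd : aeval (a + algebraMap F A c) (∏ r ∈ t.image (· + c), (X - C r)) = 0 := by
      rw [Finset.prod_image fun _ _ _ _ h => add_right_cancel h, ← ht]
      simp [map_prod]
    exact zero_dvd_iff.mp (hd ▸ map_dvd (aeval (a + algebraMap F A c))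
      (Finset.prod_dvd_prod_of_subset _ _ _ Finset.subset_union_right))
  have h₃ : aeval (a + c • e) q * e = aeval (a + algebraMap F A c) q * e := by
    refine aeval_mul_eq_of_mul_eq ?_ q
    rw [Algebra.smul_def]
    linear_combination algebraMap F A c * he'
  have h₄ : aeval (a + c • e) q * (1 - e) = aeval a q * (1 - e) := by
    refine aeval_mul_eq_of_mul_eq ?_ q
    rw [Algebra.smul_def]
    linear_combination -algebraMap F A c * he'
  linear_combination h₃ + h₄ + e * h₂ + (1 - e) * h₁

theorem exists_aeval_prod_X_sub_C_eq_zero_of_mem_adjoin {a : A}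
    (ha : a ∈ Algebra.adjoin F {e : A | IsIdempotentElem e}) :
    ∃ t : Finset F, aeval a (∏ r ∈ t, (X - C r)) = 0 := by
  let S : Submonoid A :=
    { carrier := {e : A | IsIdempotentElem e}
      one_mem' := IsIdempotentElem.one
      mul_mem' := fun h₁ h₂ => h₁.mul h₂ }
  have hS : ((Submonoid.closure {e : A | IsIdempotentElem e} : Submonoid A) : Set A) ⊆
      Submodule.span F {e : A | IsIdempotentElem e} :=
    fun _ hy => Submodule.subset_span ((Submonoid.closure_le (S := S)).mpr subset_rfl hy)
  rw [← Subalgebra.mem_toSubmodule, Algebra.adjoin_eq_span_of_subset F hS,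
    Submodule.mem_span_set'] at ha
  obtain ⟨n, f, g, rfl⟩ := ha
  induction (Finset.univ : Finset (Fin n)) using Finset.cons_induction with
  | empty => exact ⟨{0}, by simp⟩
  | cons i s hi ih =>
    rw [Finset.sum_cons, add_comm]
    exact exists_aeval_prod_X_sub_C_eq_zero_add_smul (g i).2 (f i) ih

theorem aeval_eq_zero_of_eval_eq_zero {a : A} {t : Finset F}
    (ha : aeval a (∏ r ∈ t, (X - C r)) = 0) {p : F[X]} (hp : ∀ r ∈ t, p.eval r = 0) :
    aeval a p = 0 := by
  have hd : ∏ r ∈ t, (X - C r) ∣ p :=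
    Finset.prod_dvd_of_coprime
      (fun _ _ _ _ h => pairwise_coprime_X_sub_C Function.injective_id h)
      fun r hr => dvd_iff_isRoot.mpr (hp r hr)
  exact zero_dvd_iff.mp (ha ▸ map_dvd (aeval a) hd)

theorem mem_adjoin_isIdempotentElem_of_aeval_prod_X_sub_C_eq_zero {a : A} {t : Finset F}
    (ha : aeval a (∏ r ∈ t, (X - C r)) = 0) :
    a ∈ Algebra.adjoin F {e : A | IsIdempotentElem e} := by
  classical
  have hinj : Set.InjOn (id : F → F) t := Function.injective_id.injOn
  have hidem (i : F) (hi : i ∈ t) : IsIdempotentElem (aeval a (Lagrange.basis t id i)) := by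
    rw [IsIdempotentElem, ← sub_eq_zero, ← map_mul, ← map_sub]
    refine aeval_eq_zero_of_eval_eq_zero ha fun r hr => ?_
    rcases eq_or_ne i r with rfl | hir
    · have := Lagrange.eval_basis_self hinj hi
      simp_all
    · have := Lagrange.eval_basis_of_ne (v := (id : F → F)) hir hr
      simp_all
  have hsum : aeval a (X - Lagrange.interpolate t id id) = 0 :=
    aeval_eq_zero_of_eval_eq_zero ha fun r hr => by
      have := Lagrange.eval_interpolate_at_node (id : F → F) hinj hr
      simp_all
  rw [map_sub, aeval_X, sub_eq_zero, Lagrange.interpolate_apply, map_sum] at hsum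
  rw [hsum]
  refine Subalgebra.sum_mem _ fun i hi => ?_
  rw [map_mul, aeval_C]
  exact Subalgebra.mul_mem _ (Subalgebra.algebraMap_mem _ _)
    (Algebra.subset_adjoin (hidem i hi))

end Idempotents

section BaseChange

open Polynomial

theorem map_minpoly_dvd_of_aeval_one_tmul_eq_zero {K L M : Type*} [Field K] [CommRing L] [Field M]
    [Algebra K L] [Algebra K M] {x : L} (hx : IsIntegral K x) {p : M[X]}
    (hp : aeval ((1 : M) ⊗ₜ[K] x) p = 0) : (minpoly K x).map (algebraMap K M) ∣ p := by
  have hmonic := (minpoly.monic hx).map (algebraMap K M)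
  set f := (minpoly K x).map (algebraMap K M) with hf
  have hfx : aeval ((1 : M) ⊗ₜ[K] x) f = 0 := by
    have := aeval_algHom_apply (Algebra.TensorProduct.includeRight : L →ₐ[K] M ⊗[K] L) x
      (minpoly K x)
    rw [hf, aeval_map_algebraMap]
    simpa using this
  rw [← modByMonic_eq_zero_iff_dvd hmonic]
  have hr : aeval ((1 : M) ⊗ₜ[K] x) (p %ₘ f) = 0 := by
    rw [modByMonic_eq_sub_mul_div p f, map_sub, map_mul, hfx, hp, zero_mul, sub_zero]
  have hdeg : (p %ₘ f).degree < ((minpoly K x).natDegree : WithBot ℕ) := by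
    rw [← degree_eq_natDegree (minpoly.ne_zero hx), ← degree_map (minpoly K x) (algebraMap K M)]
    exact degree_modByMonic_lt _ hmonic
  have hli := Module.Flat.linearIndependent_one_tmul (S := M) (linearIndependent_pow (K := K) x)
  rw [aeval_eq_sum_range' (n := (minpoly K x).natDegree + 1)
    (Nat.lt_succ_of_le (natDegree_le_of_degree_le hdeg.le)), Finset.sum_range_succ,
    coeff_eq_zero_of_degree_lt hdeg, zero_smul, add_zero, Finset.sum_range] at hr
  have hcoeff := Fintype.linearIndependent_iff.mp hli (fun i => (p %ₘ f).coeff i) (by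
    simpa [Algebra.TensorProduct.tmul_pow] using hr)
  ext n
  rcases lt_or_ge n (minpoly K x).natDegree with hn | hn
  · exact hcoeff ⟨n, hn⟩
  · exact coeff_eq_zero_of_degree_lt (hdeg.trans_le (by exact_mod_cast hn))

end BaseChange

theorem separable_iff_generated_by_idempotents_of_intermediate
    (K L M : Type*) [Field K] [Field L] [Field M]
    [Algebra K L] [Algebra L M] [Algebra K M] [IsScalarTower K L M]
    [IsAlgClosed M] [Algebra.IsAlgebraic K M] :
    Algebra.IsSeparable K L ↔
      Algebra.adjoin M {e : M ⊗[K] L | IsIdempotentElem e} = ⊤ := by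
  constructor
  · intro _
    rw [eq_top_iff]
    rintro z -
    induction z using TensorProduct.induction_on with
    | zero => exact Subalgebra.zero_mem _
    | add y z hy hz => exact Subalgebra.add_mem _ hy hz
    | tmul m x =>
      have hmx : m ⊗ₜ[K] x = m • ((1 : M) ⊗ₜ[K] x) := by simp [TensorProduct.smul_tmul']
      rw [hmx]
      refine Subalgebra.smul_mem _ ?_ m
      have hx := Algebra.IsSeparable.isIntegral K x
      set f := (minpoly K x).map (algebraMap K M) with hf
      have hsep : f.Separable :=
        (Polynomial.separable_map (algebraMap K M)).mpr (Algebra.IsSeparable.isSeparable K x)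
      have hprod := (IsAlgClosed.splits f).eq_prod_roots_of_monic ((minpoly.monic hx).map _)
      refine mem_adjoin_isIdempotentElem_of_aeval_prod_X_sub_C_eq_zero
        (t := ⟨f.roots, Polynomial.nodup_roots hsep⟩) ?_
      rw [Finset.prod_mk, ← hprod, hf, Polynomial.aeval_map_algebraMap]
      simpa using Polynomial.aeval_algHom_apply
        (Algebra.TensorProduct.includeRight : L →ₐ[K] M ⊗[K] L) x (minpoly K x)
  · intro h
    refine ⟨fun x => ?_⟩
    have hx : IsIntegral K x :=
      (isIntegral_algebraMap_iff (algebraMap L M).injective).mp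
        (Algebra.IsIntegral.isIntegral (R := K) (algebraMap L M x))
    obtain ⟨t, ht⟩ := exists_aeval_prod_X_sub_C_eq_zero_of_mem_adjoin
      (h ▸ Algebra.mem_top : (1 : M) ⊗ₜ[K] x ∈ _)
    have hsep : (∏ r ∈ t, (Polynomial.X - Polynomial.C r) : Polynomial M).Separable :=
      Polynomial.separable_prod_X_sub_C_iff'.mpr fun _ _ _ _ h => h
    exact (Polynomial.separable_map (algebraMap K M)).mp
      (hsep.of_dvd (map_minpoly_dvd_of_aeval_one_tmul_eq_zero hx ht))
end

section
/- Let M be an algebraically closed field containing a field K, and let L be a field extension of K that is algebraic over K. Then L is separable over K if and only if every element of the tensor product M ⊗_K L is a unit times an idempotent, i.e., for every x ∈ M ⊗_K L there exist a unit u and an idempotent e with x = u·e. -/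
open TensorProduct

theorem IsArtinianRing.exists_eq_unit_mul_isIdempotentElem {R : Type*} [CommRing R]
    [IsArtinianRing R] [IsReduced R] (x : R) :
    ∃ (u : Rˣ) (e : R), IsIdempotentElem e ∧ x = u * e := by
  classical
  let φ := IsArtinianRing.equivPi R
  let _ (m : MaximalSpectrum R) : Field (R ⧸ m.asIdeal) := Ideal.Quotient.field _
  let v : ∀ m : MaximalSpectrum R, R ⧸ m.asIdeal := fun m ↦ if φ x m = 0 then 1 else φ x m
  let e : ∀ m : MaximalSpectrum R, R ⧸ m.asIdeal := fun m ↦ if φ x m = 0 then 0 else 1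
  have hv : IsUnit v := Pi.isUnit_iff.mpr fun m ↦ isUnit_iff_ne_zero.mpr <| by
    by_cases h : φ x m = 0
    · simp [v, h]
    · simp [v, h]
  have he : IsIdempotentElem e := by
    ext m
    by_cases h : φ x m = 0 <;> simp [e, h]
  refine ⟨(hv.map φ.symm).unit, φ.symm e, he.map φ.symm, φ.injective ?_⟩
  rw [IsUnit.unit_spec, ← map_mul, AlgEquiv.apply_symm_apply]
  ext m
  by_cases h : φ x m = 0
  · simp [v, e, h]
  · simp [v, e, h]

theorem isReduced_of_forall_eq_unit_mul_isIdempotentElem {R : Type*} [CommRing R]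
    (h : ∀ x : R, ∃ (u : Rˣ) (e : R), IsIdempotentElem e ∧ x = u * e) : IsReduced R where
  eq_zero x hx := by
    obtain ⟨u, e, he, rfl⟩ := h x
    obtain ⟨n, hn⟩ := hx
    have hn' : (u * e : R) ^ (n + 1) = 0 := by rw [pow_succ, hn, zero_mul]
    rw [mul_pow, he.pow_succ_eq n, ← Units.val_pow_eq_pow_val, Units.mul_right_eq_zero] at hn'
    rw [hn', mul_zero]

section

variable {K L : Type*} (M : Type*) [Field K] [Field L] [Field M] [Algebra K L] [Algebra K M]

theorem IntermediateField.exists_finiteDimensional_mem_range_map [Algebra.IsAlgebraic K L]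
    (x : M ⊗[K] L) :
    ∃ F : IntermediateField K L, FiniteDimensional K F ∧
      x ∈ (Algebra.TensorProduct.map (AlgHom.id M M) F.val).range := by
  obtain ⟨D, ⟨s, rfl⟩, y, rfl⟩ := exists_fg_and_mem_baseChange x
  refine ⟨IntermediateField.adjoin K (s : Set L), IntermediateField.finiteDimensional_adjoin
    fun a _ ↦ Algebra.IsIntegral.isIntegral a, Algebra.TensorProduct.map (AlgHom.id M M)
      (Subalgebra.inclusion (IntermediateField.algebra_adjoin_le_adjoin K (s : Set L))) y, ?_⟩
  induction y with
  | zero => simp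
  | add a b ha hb => simp only [map_add, ha, hb]
  | tmul a b => rfl

theorem isReduced_tensorProduct_of_isSeparable_s18 [Algebra.IsSeparable K L] [FiniteDimensional K L] :
    IsReduced (M ⊗[K] L) :=
  have := Algebra.FormallyUnramified.of_isSeparable K L
  Algebra.FormallyUnramified.isReduced_of_field M (M ⊗[K] L)

theorem aeval_one_tmul_minpoly (a : L) :
    Polynomial.aeval ((1 : M) ⊗ₜ[K] a) (minpoly K a) = 0 := by
  rw [← Algebra.TensorProduct.includeRight_apply, Polynomial.aeval_algHom_apply, minpoly.aeval,
    map_zero]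

open Polynomial in
theorem minpoly_map_dvd_of_aeval_one_tmul_eq_zero {a : L} (ha : IsIntegral K a) {g : M[X]}
    (hg : aeval ((1 : M) ⊗ₜ[K] a) g = 0) : (minpoly K a).map (algebraMap K M) ∣ g := by
  set p := (minpoly K a).map (algebraMap K M)
  have hp : p.Monic := (minpoly.monic ha).map _
  have hdeg : p.natDegree = (minpoly K a).natDegree := natDegree_map _
  have hpa : aeval ((1 : M) ⊗ₜ[K] a) p = 0 := by
    rw [aeval_map_algebraMap, aeval_one_tmul_minpoly]
  have hr : aeval ((1 : M) ⊗ₜ[K] a) (g %ₘ p) = 0 := by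
    rw [← modByMonic_add_div g p] at hg
    simpa [hpa] using hg
  rw [← modByMonic_eq_zero_iff_dvd hp]
  by_contra hne
  have hlt : (g %ₘ p).natDegree < (minpoly K a).natDegree :=
    hdeg ▸ natDegree_lt_natDegree hne (degree_modByMonic_lt g hp)
  have hli := Fintype.linearIndependent_iff.mp
    (Module.Flat.linearIndependent_one_tmul (S := M) (linearIndependent_pow (K := K) a))
    (fun i ↦ (g %ₘ p).coeff i)
  rw [aeval_eq_sum_range' hlt, ← Fin.sum_univ_eq_sum_range
    (fun i ↦ (g %ₘ p).coeff i • ((1 : M) ⊗ₜ[K] a) ^ i)] at hr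
  simp only [Algebra.TensorProduct.tmul_pow, one_pow] at hr
  exact hne (leadingCoeff_eq_zero.mp (hli hr ⟨_, hlt⟩))

theorem isSeparable_of_isReduced_tensorProduct_s18 [PerfectField M] [Algebra.IsAlgebraic K L]
    [IsReduced (M ⊗[K] L)] : Algebra.IsSeparable K L where
  isSeparable' a := by
    have ha : IsIntegral K a := Algebra.IsIntegral.isIntegral a
    have hp := ((minpoly.monic ha).map (algebraMap K M)).ne_zero
    rw [IsSeparable, ← Polynomial.separable_map (algebraMap K M),
      PerfectField.separable_iff_squarefree]
    refine IsRadical.squarefree hp fun n g hg ↦ minpoly_map_dvd_of_aeval_one_tmul_eq_zero M ha ?_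
    obtain ⟨q, hq⟩ := hg
    refine eq_zero_of_pow_eq_zero (n := n) ?_
    rw [← map_pow, hq, map_mul, Polynomial.aeval_map_algebraMap, aeval_one_tmul_minpoly, zero_mul]

end

theorem separable_iff_unit_times_idempotent
    (K L M : Type*) [Field K] [Field L] [Field M]
    [Algebra K L] [Algebra K M]
    [IsAlgClosed M] [Algebra.IsAlgebraic K L] :
    Algebra.IsSeparable K L ↔
      ∀ x : M ⊗[K] L, ∃ (u : (M ⊗[K] L)ˣ) (e : M ⊗[K] L),
        IsIdempotentElem e ∧ x = (u : M ⊗[K] L) * e := by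
  refine ⟨fun _ x ↦ ?_, fun h ↦ ?_⟩
  · obtain ⟨F, _, y, rfl⟩ := IntermediateField.exists_finiteDimensional_mem_range_map M x
    have := Algebra.isSeparable_tower_bot_of_isSeparable K F L
    have := isReduced_tensorProduct_of_isSeparable_s18 (K := K) (L := F) M
    have : IsArtinianRing (M ⊗[K] F) := isArtinian_of_tower M inferInstance
    obtain ⟨u, e, he, hy⟩ := IsArtinianRing.exists_eq_unit_mul_isIdempotentElem y
    let φ := Algebra.TensorProduct.map (AlgHom.id M M) F.val
    exact ⟨Units.map φ u, φ e, he.map φ, by simpa [φ] using congrArg φ hy⟩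
  · have := isReduced_of_forall_eq_unit_mul_isIdempotentElem h
    exact isSeparable_of_isReduced_tensorProduct_s18 M
end
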